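/- Let n ≥ 1, let U ⊆ ℝⁿ be an open set with ℝ^{>0}·U ⊆ U, let k > 1 be real, let h : U → ℝ be smooth, positive, and positively homogeneous of degree k, assume that for every x ∈ U the restriction of −(D²h)ₓ to ker((Dh)ₓ) is positive definite, and let c < 0. Then for every x ∈ U_c = {x ∈ U : h(x) + c > 0} and every v ∈ ℝⁿ: g'_c(x)(v, v) ≥ (1/k)·((D(log(h+c)))ₓ(v))², where g'_c(x) = −(D²(log(h+c)))ₓ. -/

import Mathlib

noncomputable section

/-- The second derivative of `f` at `x`, as a bilinear form: `(D²f)ₓ(u, v)`. -/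
def D2 {n : ℕ} (f : (Fin n → ℝ) → ℝ) (x u v : Fin n → ℝ) : ℝ :=
  fderiv ℝ (fderiv ℝ f) x u v

/-- The symmetric bilinear form `g_U(x) = −(D²h)ₓ`. -/
def gU {n : ℕ} (h : (Fin n → ℝ) → ℝ) (x u v : Fin n → ℝ) : ℝ := -D2 h x u v

/-- The symmetric bilinear form `g'_c(x) = −(D²(log(h+c)))ₓ`. -/
def gprimec {n : ℕ} (h : (Fin n → ℝ) → ℝ) (c : ℝ) (x u v : Fin n → ℝ) : ℝ :=
  -D2 (fun y => Real.log (h y + c)) x u v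

/-- Euler's identity for a function that is positively homogeneous of real degree `k` along
the ray through `x`. -/
theorem fderiv_apply_self_of_homogeneous {E : Type*} [NormedAddCommGroup E] [NormedSpace ℝ E]
    {h : E → ℝ} {x : E} {k : ℝ} (hd : DifferentiableAt ℝ h x)
    (hhom : ∀ l : ℝ, 0 < l → h (l • x) = l ^ k * h x) :
    fderiv ℝ h x x = k * h x := by
  have hray : HasDerivAt (fun l : ℝ => l • x) x 1 := by
    simpa using (hasDerivAt_id (1 : ℝ)).smul_const x
  have hfd : HasFDerivAt h (fderiv ℝ h x) ((1 : ℝ) • x) := by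
    simpa using hd.hasFDerivAt
  have hcomp : HasDerivAt (fun l : ℝ => h (l • x)) (fderiv ℝ h x x) 1 :=
    hfd.comp_hasDerivAt (1 : ℝ) hray
  have hpow : HasDerivAt (fun l : ℝ => l ^ k * h x) (k * h x) 1 := by
    simpa using (Real.hasDerivAt_rpow_const (x := 1) (p := k) (Or.inl one_ne_zero)).mul_const (h x)
  refine hcomp.unique (hpow.congr_of_eventuallyEq ?_)
  filter_upwards [lt_mem_nhds (zero_lt_one (α := ℝ))] with l hl using hhom l hl

/-- The derivative of Euler's identity. -/
theorem fderiv_fderiv_apply_self_of_euler {E : Type*} [NormedAddCommGroup E] [NormedSpace ℝ E]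
    {h : E → ℝ} {x : E} {k : ℝ} (hd : DifferentiableAt ℝ h x)
    (hd' : DifferentiableAt ℝ (fderiv ℝ h) x)
    (heuler : ∀ᶠ y in nhds x, fderiv ℝ h y y = k * h y) (v : E) :
    fderiv ℝ (fderiv ℝ h) x v x = (k - 1) * fderiv ℝ h x v := by
  have hleft := hd'.hasFDerivAt.clm_apply (hasFDerivAt_id x)
  have hright := (hd.hasFDerivAt.const_mul k).congr_of_eventuallyEq heuler
  have heq := congrArg (fun L => L v) (hleft.unique hright)
  simp at heq
  linarith

/-- The first derivative of `log (h + c)`. -/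
theorem fderiv_log_add_const {E : Type*} [NormedAddCommGroup E] [NormedSpace ℝ E]
    {h : E → ℝ} {x : E} {c : ℝ} (hd : DifferentiableAt ℝ h x) (hx : h x + c ≠ 0) :
    fderiv ℝ (fun y => Real.log (h y + c)) x = (h x + c)⁻¹ • fderiv ℝ h x :=
  ((hd.hasFDerivAt.add_const c).log hx).fderiv

/-- The second derivative of `log (h + c)`. -/
theorem fderiv_fderiv_log_add_const_apply {E : Type*} [NormedAddCommGroup E] [NormedSpace ℝ E]
    {h : E → ℝ} {x : E} {c : ℝ} (hd : ∀ᶠ y in nhds x, DifferentiableAt ℝ h y)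
    (hd' : DifferentiableAt ℝ (fderiv ℝ h) x) (hx : h x + c ≠ 0) (u v : E) :
    fderiv ℝ (fderiv ℝ (fun y => Real.log (h y + c))) x u v =
      fderiv ℝ (fderiv ℝ h) x u v / (h x + c) -
        fderiv ℝ h x u * fderiv ℝ h x v / (h x + c) ^ 2 := by
  have hdx := hd.self_of_nhds
  have hne : ∀ᶠ y in nhds x, h y + c ≠ 0 :=
    (hdx.continuousAt.add continuousAt_const).eventually_ne hx
  have hfirst : fderiv ℝ (fun y => Real.log (h y + c)) =ᶠ[nhds x]
      fun y => (h y + c)⁻¹ • fderiv ℝ h y := by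
    filter_upwards [hd, hne] with y hy hy' using fderiv_log_add_const hy hy'
  have hinv : HasFDerivAt (fun y => (h y + c)⁻¹) (-((h x + c) ^ 2)⁻¹ • fderiv ℝ h x) x :=
    (hasDerivAt_inv hx).comp_hasFDerivAt x (hdx.hasFDerivAt.add_const c)
  have hsecond : HasFDerivAt (fun y => (h y + c)⁻¹ • fderiv ℝ h y) _ x :=
    hinv.smul hd'.hasFDerivAt
  rw [hfirst.fderiv_eq, hsecond.fderiv]
  simp
  ring

/-- If `B` is a symmetric bilinear form with `B(v, x) = (k - 1) p(v)`, where `p(x) = k H`, and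
`B` is nonpositive on `ker p`, then `B(v, v) ≤ (k - 1) p(v)² / (k H)`. -/
theorem bilin_apply_self_le_of_nonpos_on_ker {E : Type*} [NormedAddCommGroup E]
    [NormedSpace ℝ E] (B : E →L[ℝ] E →L[ℝ] ℝ) (p : E →L[ℝ] ℝ) {x : E} {k H : ℝ}
    (hkH : k * H ≠ 0) (hsymm : ∀ u v, B u v = B v u)
    (hBx : ∀ v, B v x = (k - 1) * p v) (hpx : p x = k * H)
    (hker : ∀ w, p w = 0 → B w w ≤ 0) (v : E) :
    B v v ≤ (k - 1) * p v ^ 2 / (k * H) := by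
  set a := p v / (k * H) with ha
  have hav : p v = a * (k * H) := (div_mul_cancel₀ _ hkH).symm
  have hle := hker (v - a • x) (by simp [hpx, hav])
  have hexp : B (v - a • x) (v - a • x) = B v v - (k - 1) * p v ^ 2 / (k * H) := by
    have hdiv : (k - 1) * p v ^ 2 / (k * H) = (k - 1) * p v * a := by rw [ha]; ring
    simp only [map_sub, map_smul, sub_apply, smul_apply,
      smul_eq_mul, hsymm x v, hBx, hpx, hdiv]
    rw [hav]
    ring
  linarith

/-- Let `h` be smooth, positive and positively homogeneous of degree `k > 1` on an
open cone `U ⊆ ℝⁿ`, with `−D²h` positive definite on `ker Dh`, and let `c < 0`.  Then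
for every `x ∈ U_c = {x ∈ U : h(x) + c > 0}` and every `v`:
`g'_c(x)(v,v) ≥ (1/k)·((D(log(h+c)))ₓ(v))²`. -/
theorem stmt17 {n : ℕ} (hn : 1 ≤ n)
    (U : Set (Fin n → ℝ)) (hU : IsOpen U)
    (hcone : ∀ l : ℝ, 0 < l → ∀ x ∈ U, l • x ∈ U)
    (k : ℝ) (hk : 1 < k)
    (h : (Fin n → ℝ) → ℝ) (hsm : ContDiffOn ℝ (⊤ : ℕ∞) h U)
    (hpos : ∀ x ∈ U, 0 < h x)
    (hhom : ∀ l : ℝ, 0 < l → ∀ x ∈ U, h (l • x) = l ^ k * h x)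
    (hker : ∀ x ∈ U, ∀ v : Fin n → ℝ, fderiv ℝ h x v = 0 → v ≠ 0 → 0 < gU h x v v)
    (c : ℝ) (hc : c < 0) :
    ∀ x ∈ {x ∈ U | 0 < h x + c}, ∀ v : Fin n → ℝ,
      (1 / k) * (fderiv ℝ (fun y => Real.log (h y + c)) x v) ^ 2 ≤ gprimec h c x v v := by
  rintro x ⟨hxU, hxc⟩ v
  have hsmooth : ∀ y ∈ U, ContDiffAt ℝ (⊤ : ℕ∞) h y := fun y hy =>
    hsm.contDiffAt (hU.mem_nhds hy)
  have hdiff : ∀ y ∈ U, DifferentiableAt ℝ h y := fun y hy =>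
    (hsmooth y hy).differentiableAt (by simp)
  have hdiff' : DifferentiableAt ℝ (fderiv ℝ h) x :=
    ((hsmooth x hxU).fderiv_right (m := 1) (by norm_cast)).differentiableAt one_ne_zero
  have hsymm : IsSymmSndFDerivAt ℝ h x :=
    (hsmooth x hxU).isSymmSndFDerivAt (by simp; norm_cast)
  have heuler : ∀ y ∈ U, fderiv ℝ h y y = k * h y := fun y hy =>
    fderiv_apply_self_of_homogeneous (hdiff y hy) fun l hl => hhom l hl y hy
  have hHpos := hpos x hxU
  have hkH : 0 < k * h x := by positivity
  have hbound := bilin_apply_self_le_of_nonpos_on_ker (fderiv ℝ (fderiv ℝ h) x) (fderiv ℝ h x)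
    hkH.ne' (fun u w => hsymm u w)
    (fderiv_fderiv_apply_self_of_euler (hdiff x hxU) hdiff'
      (Filter.mem_of_superset (hU.mem_nhds hxU) heuler))
    (heuler x hxU)
    (fun w hw => by
      rcases eq_or_ne w 0 with rfl | hw0
      · simp
      · have := hker x hxU w hw hw0
        simp only [gU, D2] at this
        linarith) v
  rw [gprimec, D2, fderiv_fderiv_log_add_const_apply
    (Filter.mem_of_superset (hU.mem_nhds hxU) hdiff) hdiff' hxc.ne',
    fderiv_log_add_const (hdiff x hxU) hxc.ne']
  simp only [smul_apply, smul_eq_mul]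
  generalize fderiv ℝ h x v = p at *
  generalize fderiv ℝ (fderiv ℝ h) x v v = b at *
  have hdiv := div_le_div_of_nonneg_right hbound hxc.le
  have hgap : 0 ≤ (k - 1) * p ^ 2 * (-c) / (k * h x * (h x + c) ^ 2) := by
    have : 0 ≤ k - 1 := by linarith
    have : 0 ≤ -c := by linarith
    positivity
  have hident : p * p / (h x + c) ^ 2 - (k - 1) * p ^ 2 / (k * h x) / (h x + c) -
      1 / k * ((h x + c)⁻¹ * p) ^ 2 = (k - 1) * p ^ 2 * (-c) / (k * h x * (h x + c) ^ 2) := by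
    have := hxc.ne'
    field_simp
    ring
  linarith
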